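/- Let I be a workflow instance with constraint graph G and let (T, X) be a rooted tree decomposition of the Hasse diagram D of (U, <). Let i be an introduce node with bag B = {u_1, …, u_p} whose unique child has bag B' = {u_1, …, u_{p−1}}, so u_p ∉ B'. Let T' ⊆ S, R : T' → B ∪ {[<],[>],[∼]}^{p}, X_p = {x ∈ T' : R(x) = u_p}, T'' = T' \ X_p, and let R' : T'' → B' ∪ {[<],[>],[∼]}^{p−1} be defined by R'(x) = R(x) if R(x) ∈ B', and, writing R(x) = (x_{u_1}, …, x_{u_p}) otherwise, R'(x) = (x_{u_1}, …, x_{u_{p−1}}). Then a (B, T', R)-plan exists if and only if the following eight conditions all hold: (1) u_p ∈ L(x) for each x ∈ X_p; (2) there is no edge and no arc of G between two steps of X_p; (3) for every arc of G from y ∉ X_p to x ∈ X_p, either R(y) = u for some u ∈ B' with u < u_p, or R(y) is a tuple whose u_p-coordinate is [<]; (4) for every arc of G from x ∈ X_p to y ∉ X_p, either R(y) = u for some u ∈ B' with u_p < u, or R(y) is a tuple whose u_p-coordinate is [>]; (5) for every y ∉ X_p with R(y) a tuple whose u_p-coordinate is [<], there exists u_i ∈ B' with u_i < u_p and the u_i-coordinate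 of R(y) equal to [<]; (6) for every y ∉ X_p with R(y) a tuple whose u_p-coordinate is [>], there exists u_i ∈ B' with u_p < u_i and the u_i-coordinate of R(y) equal to [>]; (7) for every y ∉ X_p with R(y) a tuple whose u_p-coordinate is [∼], there is no u_i ∈ B with (the u_i-coordinate of R(y) equal to [<] and u_i < u_p) and no u_i ∈ B with (the u_i-coordinate of R(y) equal to [>] and u_p < u_i); (8) a (B', T'', R')-plan exists. -/

import Mathlib

/-- The three symbols `[<]`, `[>]`, `[∼]`. -/
inductive Rel3 : Type where
  | lt : Rel3
  | gt : Rel3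
  | sim : Rel3
deriving DecidableEq

open Classical in
/-- The relation `φ(v, u)` of a user `v` to a user `u`: `[<]` if `v < u`, `[>]` if
`u < v`, and `[∼]` otherwise. -/
noncomputable def phi {U : Type*} [PartialOrder U] (v u : U) : Rel3 :=
  if v < u then Rel3.lt else if u < v then Rel3.gt else Rel3.sim

/-- `j` is a descendant of `i` in the tree `T` rooted at `r`: `j ≠ i` and `i` lies on
the (unique) path in `T` from the root `r` to `j`. -/
def IsDesc {ι : Type*} (T : SimpleGraph ι) (r i j : ι) : Prop :=
  j ≠ i ∧ ∀ p : T.Walk r j, p.IsPath → i ∈ p.support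

/-- The set of users lying in the bag of node `i` or in the bag of a descendant of `i`
(in the tree `T` with bags `Bags`, rooted at `r`). -/
def allowedUsers {ι U : Type*} (T : SimpleGraph ι) (r : ι) (Bags : ι → Set U) (i : ι) :
    Set U :=
  Bags i ∪ ⋃ j ∈ {j | IsDesc T r i j}, Bags j

/-- A `(B, T', R)`-plan for the workflow instance with authorization lists `L`,
separation-of-duty constraints `Gne` (the undirected edges of the constraint graph),
seniority constraints `Glt` (the arcs of the constraint graph), bag `Bag`, and set
`Allowed` of users lying in `Bag` or in the bag of a descendant node.  Here the values
of `R` and `π` are relevant only on the set `T'` of steps; tuples over the bag are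
represented as functions `↥Bag → Rel3`. -/
def IsBTRPlan {S U : Type*} [PartialOrder U]
    (L : S → Set U) (Gne Glt : S → S → Prop)
    (Bag Allowed : Set U) (T' : Set S)
    (R : S → ↥Bag ⊕ (↥Bag → Rel3)) (π : S → U) : Prop :=
  (∀ x ∈ T', π x ∈ L x) ∧
  (∀ x ∈ T', ∀ y ∈ T', Gne x y → π x ≠ π y) ∧
  (∀ x ∈ T', ∀ y ∈ T', Glt x y → π x < π y) ∧
  (∀ x ∈ T', π x ∈ Allowed) ∧
  (∀ x ∈ T', ∀ u : ↥Bag, (π x = ↑u ↔ R x = Sum.inl u)) ∧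
  (∀ x ∈ T', ∀ f : ↥Bag → Rel3, R x = Sum.inr f → ∀ u : ↥Bag, phi (π x) ↑u = f u)

lemma phi_eq_lt_iff {U : Type*} [PartialOrder U] {v u : U} : phi v u = Rel3.lt ↔ v < u := by
  unfold phi
  split_ifs <;> simp_all

lemma phi_eq_gt_iff {U : Type*} [PartialOrder U] {v u : U} : phi v u = Rel3.gt ↔ u < v := by
  unfold phi
  split_ifs with h h'
  · simpa using h.not_gt
  · simpa using h'
  · simpa using h'

lemma phi_eq_of_iff {U : Type*} [PartialOrder U] {v u : U} {s : Rel3}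
    (hlt : v < u ↔ s = Rel3.lt) (hgt : u < v ↔ s = Rel3.gt) : phi v u = s := by
  rw [← phi_eq_lt_iff] at hlt
  rw [← phi_eq_gt_iff] at hgt
  cases hp : phi v u <;> cases s <;> simp_all

/-- `i` lies on every path of `T` from the root `r` to `j`, that is, `j` is `i` or a descendant
of `i`. -/
def IsWeakDesc {ι : Type*} (T : SimpleGraph ι) (r i j : ι) : Prop :=
  ∀ p : T.Walk r j, p.IsPath → i ∈ p.support

lemma IsWeakDesc.refl {ι : Type*} (T : SimpleGraph ι) (r i : ι) : IsWeakDesc T r i i :=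
  fun p _ => p.end_mem_support

open Classical in
lemma IsWeakDesc.trans {ι : Type*} {T : SimpleGraph ι} {r i j k : ι}
    (hij : IsWeakDesc T r i j) (hjk : IsWeakDesc T r j k) : IsWeakDesc T r i k := fun p hp =>
  p.support_takeUntil_subset_support (hjk p hp) (hij _ (hp.takeUntil (hjk p hp)))

open Classical in
lemma IsWeakDesc.antisymm {ι : Type*} {T : SimpleGraph ι} (hT : T.Connected) {r i j : ι}
    (hij : IsWeakDesc T r i j) (hji : IsWeakDesc T r j i) : i = j := by
  by_contra hne
  obtain ⟨p, hp⟩ := hT.exists_isPath r i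
  exact SimpleGraph.Walk.endpoint_notMem_support_takeUntil hp (hji p hp) hne
    (hij _ (hp.takeUntil _))

open Classical in
/-- The only edges of `T` that leave the subtree rooted at `i` are incident to `i`. -/
lemma IsWeakDesc.eq_of_adj {ι : Type*} {T : SimpleGraph ι} {r i a b : ι}
    (ha : IsWeakDesc T r i a) (hb : ¬ IsWeakDesc T r i b) (hab : T.Adj a b) : a = i := by
  simp only [IsWeakDesc, not_forall] at hb
  obtain ⟨p, hp, hip⟩ := hb
  by_cases hap : a ∈ p.support
  · exact absurd (p.support_takeUntil_subset_support hap (ha _ (hp.takeUntil hap))) hip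
  · have := ha (p.concat hab.symm) (hp.concat hap hab.symm)
    rw [SimpleGraph.Walk.support_concat] at this
    simp_all

open Classical in
lemma IsDesc.isWeakDesc_of_unique_child {ι : Type*} {T : SimpleGraph ι} (hT : T.IsTree)
    {r i i' j : ι} (huniq : ∀ j, T.Adj i j → IsDesc T r i j → j = i') (hj : IsDesc T r i j) :
    IsWeakDesc T r i' j := by
  intro p hp
  have hi := hj.2 p hp
  have hspec := p.take_spec hi
  cases hq : p.dropUntil i hi with
  | nil => exact absurd rfl hj.1
  | @cons _ k _ h q =>
    have hk : k ∈ p.support := by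
      rw [← hspec, SimpleGraph.Walk.mem_support_append_iff, hq]
      simp
    have hpath : ((p.takeUntil i hi).concat h).IsPath := by
      rw [← hspec, hq, ← SimpleGraph.Walk.concat_append] at hp
      exact hp.of_append_left
    have hdesc : IsDesc T r i k := by
      refine ⟨h.ne', fun s hs => ?_⟩
      rw [hT.existsUnique_path r k |>.unique hs hpath, SimpleGraph.Walk.support_concat]
      simp
    exact huniq k h hdesc ▸ hk

lemma mem_allowedUsers_iff {ι U : Type*} {T : SimpleGraph ι} {r i : ι} {Bags : ι → Set U} {v : U} :
    v ∈ allowedUsers T r Bags i ↔ ∃ j, IsWeakDesc T r i j ∧ v ∈ Bags j := by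
  simp only [allowedUsers, Set.mem_union, Set.mem_iUnion, Set.mem_ofPred_eq, exists_prop]
  constructor
  · rintro (h | ⟨j, hj, h⟩)
    · exact ⟨i, .refl T r i, h⟩
    · exact ⟨j, hj.2, h⟩
  · rintro ⟨j, hj, h⟩
    by_cases hji : j = i
    · exact .inl (hji ▸ h)
    · exact .inr ⟨j, ⟨hji, hj⟩, h⟩

/-- A user in a bag of the subtree rooted at `i` and in a bag outside it is in the bag of `i`. -/
lemma mem_bag_of_mem_of_mem {ι U : Type*} {T : SimpleGraph ι} {r i j k : ι} {Bags : ι → Set U}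
    {v : U} (hconn : (T.induce {i | v ∈ Bags i}).Connected)
    (hj : IsWeakDesc T r i j) (hvj : v ∈ Bags j) (hk : ¬ IsWeakDesc T r i k) (hvk : v ∈ Bags k) :
    v ∈ Bags i := by
  obtain ⟨p⟩ := hconn.preconnected ⟨j, hvj⟩ ⟨k, hvk⟩
  obtain ⟨d, -, hd₁, hd₂⟩ := p.exists_boundary_dart {a | IsWeakDesc T r i a.1} hj hk
  exact hd₁.eq_of_adj hd₂ d.adj ▸ d.fst.2

/-- The bag of `i` separates the users of the subtree rooted at `i` from the others, with respect
to any relation whose related pairs share a bag. -/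
lemma exists_mem_bag_of_reflTransGen {ι U : Type*} {T : SimpleGraph ι} {r i k : ι}
    {Bags : ι → Set U} (hconn : ∀ v, (T.induce {i | v ∈ Bags i}).Connected)
    {E : U → U → Prop} (hE : ∀ a b, E a b → ∃ j, a ∈ Bags j ∧ b ∈ Bags j) {v w : U}
    (hv : v ∈ allowedUsers T r Bags i) (hk : ¬ IsWeakDesc T r i k) (hw : w ∈ Bags k)
    (h : Relation.ReflTransGen E v w) :
    ∃ u ∈ Bags i, Relation.ReflTransGen E v u ∧ Relation.ReflTransGen E u w := by
  induction h using Relation.ReflTransGen.head_induction_on with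
  | refl =>
    obtain ⟨j, hj, hvj⟩ := mem_allowedUsers_iff.1 hv
    exact ⟨w, mem_bag_of_mem_of_mem (hconn w) hj hvj hk hw, .refl, .refl⟩
  | @head a c hac hcw ih =>
    obtain ⟨m, ham, hcm⟩ := hE a c hac
    by_cases hm : IsWeakDesc T r i m
    · obtain ⟨u, hu, hcu, huw⟩ := ih (mem_allowedUsers_iff.2 ⟨m, hm, hcm⟩)
      exact ⟨u, hu, hcu.head hac, huw⟩
    · obtain ⟨j, hj, haj⟩ := mem_allowedUsers_iff.1 hv
      exact ⟨a, mem_bag_of_mem_of_mem (hconn a) hj haj hm ham, .refl, hcw.head hac⟩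

open Classical in
lemma reflTransGen_covBy_iff_le {U : Type*} [Finite U] [PartialOrder U] {a b : U} :
    Relation.ReflTransGen (· ⋖ ·) a b ↔ a ≤ b := by
  cases nonempty_fintype U
  let := Fintype.toLocallyFiniteOrder (α := U)
  exact le_iff_reflTransGen_covBy.symm

/-- Introduce node.  Let `(T, Bags)` be a rooted tree decomposition of the Hasse
diagram of `(U, <)` and let `i` be an introduce node with bag `B = Bags i` whose unique
child `i'` has bag `B' = Bags i'`, with `B = B' ∪ {up}` and `up ∉ B'`.  Let `T' ⊆ S`,
`R : S → B ⊕ (B → Rel3)`, `Xp = {x ∈ T' | R x = up}`, and `T'' = T' \ Xp`.  Then a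
`(B, T', R)`-plan exists iff the eight conditions hold: (1) `up ∈ L x` for `x ∈ Xp`;
(2) no edge and no arc of the constraint graph joins two steps of `Xp`; (3) every arc
from `y ∉ Xp` to `x ∈ Xp` has `R y = u` for some `u ∈ B'` with `u < up`, or `R y` a
tuple whose `up`-coordinate is `[<]`; (4) every arc from `x ∈ Xp` to `y ∉ Xp` has
`R y = u` for some `u ∈ B'` with `up < u`, or `R y` a tuple whose `up`-coordinate is
`[>]`; (5) if `y ∉ Xp` and `R y` is a tuple whose `up`-coordinate is `[<]`, then some
`u ∈ B'` has `u < up` and the `u`-coordinate of `R y` equal to `[<]`; (6) if `y ∉ Xp`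
and `R y` is a tuple whose `up`-coordinate is `[>]`, then some `u ∈ B'` has `up < u`
and the `u`-coordinate of `R y` equal to `[>]`; (7) if `y ∉ Xp` and `R y` is a tuple
whose `up`-coordinate is `[∼]`, then no `u ∈ B` has (`u`-coordinate `[<]` and
`u < up`) or (`u`-coordinate `[>]` and `up < u`); (8) a `(B', T'', R')`-plan exists,
where `R' x = R x` if `R x ∈ B'` and otherwise `R'` drops the `up`-coordinate of the
tuple `R x`. -/
theorem stmt_10 {S U ι : Type*} [Fintype S] [Fintype U] [Fintype ι] [PartialOrder U]
    (L : S → Set U) (Gne Glt : S → S → Prop)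
    (hGneSymm : ∀ x y, Gne x y → Gne y x)
    (hGneIrr : ∀ x, ¬ Gne x x) (hGltIrr : ∀ x, ¬ Glt x x)
    (T : SimpleGraph ι) (Bags : ι → Set U) (root : ι)
    (hTree : T.IsTree)
    (hcov : ∀ u : U, ∃ i, u ∈ Bags i)
    (harc : ∀ u v : U, u ⋖ v → ∃ i, u ∈ Bags i ∧ v ∈ Bags i)
    (hconn : ∀ u : U, (T.induce {i | u ∈ Bags i}).Connected)
    (i i' : ι) (up : U)
    (hadj : T.Adj i i') (hdesc : IsDesc T root i i')
    (huniq : ∀ j, T.Adj i j → IsDesc T root i j → j = i')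
    (hup : up ∉ Bags i') (hupmem : up ∈ Bags i)
    (hsub : Bags i' ⊆ Bags i) (hB : Bags i = insert up (Bags i'))
    (T' : Set S) (R : S → ↥(Bags i) ⊕ (↥(Bags i) → Rel3))
    (Xp : Set S) (hXp : Xp = {x | x ∈ T' ∧ R x = Sum.inl ⟨up, hupmem⟩}) :
    (∃ π : S → U,
        IsBTRPlan L Gne Glt (Bags i) (allowedUsers T root Bags i) T' R π) ↔
      ((∀ x ∈ Xp, up ∈ L x) ∧
       (∀ x ∈ Xp, ∀ y ∈ Xp, ¬ Gne x y ∧ ¬ Glt x y) ∧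
       (∀ y ∈ T', y ∉ Xp → ∀ x ∈ Xp, Glt y x →
          (∃ (u : U) (h' : u ∈ Bags i'), R y = Sum.inl ⟨u, hsub h'⟩ ∧ u < up) ∨
          (∃ f : ↥(Bags i) → Rel3, R y = Sum.inr f ∧ f ⟨up, hupmem⟩ = Rel3.lt)) ∧
       (∀ y ∈ T', y ∉ Xp → ∀ x ∈ Xp, Glt x y →
          (∃ (u : U) (h' : u ∈ Bags i'), R y = Sum.inl ⟨u, hsub h'⟩ ∧ up < u) ∨
          (∃ f : ↥(Bags i) → Rel3, R y = Sum.inr f ∧ f ⟨up, hupmem⟩ = Rel3.gt)) ∧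
       (∀ y ∈ T', y ∉ Xp → ∀ f : ↥(Bags i) → Rel3, R y = Sum.inr f →
          f ⟨up, hupmem⟩ = Rel3.lt →
          ∃ (u : U) (h' : u ∈ Bags i'), u < up ∧ f ⟨u, hsub h'⟩ = Rel3.lt) ∧
       (∀ y ∈ T', y ∉ Xp → ∀ f : ↥(Bags i) → Rel3, R y = Sum.inr f →
          f ⟨up, hupmem⟩ = Rel3.gt →
          ∃ (u : U) (h' : u ∈ Bags i'), up < u ∧ f ⟨u, hsub h'⟩ = Rel3.gt) ∧
       (∀ y ∈ T', y ∉ Xp → ∀ f : ↥(Bags i) → Rel3, R y = Sum.inr f →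
          f ⟨up, hupmem⟩ = Rel3.sim →
          ∀ u : ↥(Bags i), ¬ (f u = Rel3.lt ∧ (u : U) < up) ∧
            ¬ (f u = Rel3.gt ∧ up < (u : U))) ∧
       (∃ R' : S → ↥(Bags i') ⊕ (↥(Bags i') → Rel3),
          (∀ x ∈ T' \ Xp,
            (∀ u : ↥(Bags i), R x = Sum.inl u →
              ∃ h' : (u : U) ∈ Bags i', R' x = Sum.inl ⟨u, h'⟩) ∧
            (∀ f : ↥(Bags i) → Rel3, R x = Sum.inr f →
              R' x = Sum.inr (fun w => f (Set.inclusion hsub w)))) ∧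
          ∃ π : S → U,
            IsBTRPlan L Gne Glt (Bags i') (allowedUsers T root Bags i')
              (T' \ Xp) R' π)) := by
  have hweak : IsWeakDesc T root i i' := hdesc.2
  have hnot : ¬ IsWeakDesc T root i' i := fun h =>
    hadj.ne (hweak.antisymm hTree.connected h)
  have hup_notMem : up ∉ allowedUsers T root Bags i' := fun h => by
    obtain ⟨j, hj, hupj⟩ := mem_allowedUsers_iff.1 h
    exact hup (mem_bag_of_mem_of_mem (hconn up) hj hupj hnot hupmem)
  have hallowed : ∀ v, v ∈ allowedUsers T root Bags i' → v ∈ allowedUsers T root Bags i := by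
    intro v hv
    obtain ⟨j, hj, hvj⟩ := mem_allowedUsers_iff.1 hv
    exact mem_allowedUsers_iff.2 ⟨j, hweak.trans hj, hvj⟩
  have hmem_of_ne : ∀ v, v ∈ Bags i → v ≠ up → v ∈ Bags i' := fun v h hne =>
    Set.mem_of_mem_insert_of_ne (hB ▸ h) hne
  have hallowed' : ∀ v, v ≠ up → v ∈ allowedUsers T root Bags i →
      v ∈ allowedUsers T root Bags i' := by
    intro v hne hv
    obtain ⟨j, hj, hvj⟩ := mem_allowedUsers_iff.1 hv
    by_cases hji : j = i
    · exact mem_allowedUsers_iff.2 ⟨i', .refl T root i', hmem_of_ne v (hji ▸ hvj) hne⟩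
    · exact mem_allowedUsers_iff.2
        ⟨j, IsDesc.isWeakDesc_of_unique_child hTree huniq ⟨hji, hj⟩, hvj⟩
  have hbelow : ∀ v ∈ allowedUsers T root Bags i', v ∉ Bags i' → v < up →
      ∃ u ∈ Bags i', v < u ∧ u < up := by
    intro v hv hvB h
    obtain ⟨u, hu, hvu, huup⟩ := exists_mem_bag_of_reflTransGen hconn harc hv hnot hupmem
      (reflTransGen_covBy_iff_le.2 h.le)
    rw [reflTransGen_covBy_iff_le] at hvu huup
    exact ⟨u, hu, hvu.lt_of_ne (fun e => hvB (e ▸ hu)), huup.lt_of_ne (fun e => hup (e ▸ hu))⟩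
  have habove : ∀ v ∈ allowedUsers T root Bags i', v ∉ Bags i' → up < v →
      ∃ u ∈ Bags i', u < v ∧ up < u := by
    intro v hv hvB h
    obtain ⟨u, hu, hvu, huup⟩ := exists_mem_bag_of_reflTransGen hconn
      (E := Function.swap (· ⋖ ·)) (fun a b hab => (harc b a hab).imp fun _ => And.symm)
      hv hnot hupmem (Relation.reflTransGen_swap.2 (reflTransGen_covBy_iff_le.2 h.le))
    rw [Relation.reflTransGen_swap, reflTransGen_covBy_iff_le] at hvu huup
    exact ⟨u, hu, hvu.lt_of_ne (fun e => hvB (e ▸ hu)), huup.lt_of_ne (fun e => hup (e ▸ hu))⟩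
  have hXmem : ∀ {x}, x ∈ Xp ↔ x ∈ T' ∧ R x = Sum.inl ⟨up, hupmem⟩ := by simp [hXp]
  constructor
  · rintro ⟨π, hL, hne, hlt, hA, hinl, hinr⟩
    have hX : ∀ x ∈ Xp, π x = up := fun x hx =>
      (hinl x (hXmem.1 hx).1 ⟨up, hupmem⟩).2 (hXmem.1 hx).2
    have hnX : ∀ y ∈ T', y ∉ Xp → π y ≠ up := fun y hy hyX e =>
      hyX (hXmem.2 ⟨hy, (hinl y hy ⟨up, hupmem⟩).1 e⟩)
    have hA' : ∀ y ∈ T', y ∉ Xp → π y ∈ allowedUsers T root Bags i' := fun y hy hyX =>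
      hallowed' _ (hnX y hy hyX) (hA y hy)
    have hbag : ∀ y ∈ T', ∀ f, R y = Sum.inr f → π y ∉ Bags i' := fun y hy f hf hmem => by
      have := (hinl y hy ⟨π y, hsub hmem⟩).1 rfl
      rw [hf] at this
      cases this
    have hcase : ∀ y ∈ T', y ∉ Xp → (∃ (u : U) (h' : u ∈ Bags i'),
        R y = Sum.inl ⟨u, hsub h'⟩ ∧ π y = u) ∨
        ∃ f, R y = Sum.inr f ∧ ∀ u : ↥(Bags i), phi (π y) u = f u := by
      intro y hy hyX
      rcases hR : R y with u | f
      · have hu := (hinl y hy u).2 hR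
        exact .inl ⟨u, hmem_of_ne u u.2 (hu ▸ hnX y hy hyX), rfl, hu⟩
      · exact .inr ⟨f, rfl, hinr y hy f hR⟩
    refine ⟨fun x hx => hX x hx ▸ hL x (hXmem.1 hx).1, fun x hx y hy => ⟨fun h => ?_, fun h => ?_⟩,
      fun y hy hyX x hx h => ?_, fun y hy hyX x hx h => ?_, fun y hy hyX f hf h => ?_,
      fun y hy hyX f hf h => ?_, fun y hy hyX f hf h u => ⟨?_, ?_⟩, ?_⟩
    · exact hne x (hXmem.1 hx).1 y (hXmem.1 hy).1 h ((hX x hx).trans (hX y hy).symm)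
    · exact (hlt x (hXmem.1 hx).1 y (hXmem.1 hy).1 h).ne ((hX x hx).trans (hX y hy).symm)
    · have hl := hlt y hy x (hXmem.1 hx).1 h
      rw [hX x hx] at hl
      rcases hcase y hy hyX with ⟨u, hu, hR, e⟩ | ⟨f, hR, hf⟩
      · exact .inl ⟨u, hu, hR, e ▸ hl⟩
      · exact .inr ⟨f, hR, (hf _).symm.trans (phi_eq_lt_iff.2 hl)⟩
    · have hl := hlt x (hXmem.1 hx).1 y hy h
      rw [hX x hx] at hl
      rcases hcase y hy hyX with ⟨u, hu, hR, e⟩ | ⟨f, hR, hf⟩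
      · exact .inl ⟨u, hu, hR, e ▸ hl⟩
      · exact .inr ⟨f, hR, (hf _).symm.trans (phi_eq_gt_iff.2 hl)⟩
    · have hl := phi_eq_lt_iff.1 ((hinr y hy f hf ⟨up, hupmem⟩).trans h)
      obtain ⟨u, hu, h₁, h₂⟩ := hbelow _ (hA' y hy hyX) (hbag y hy f hf) hl
      exact ⟨u, hu, h₂, (hinr y hy f hf ⟨u, hsub hu⟩).symm.trans (phi_eq_lt_iff.2 h₁)⟩
    · have hl := phi_eq_gt_iff.1 ((hinr y hy f hf ⟨up, hupmem⟩).trans h)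
      obtain ⟨u, hu, h₁, h₂⟩ := habove _ (hA' y hy hyX) (hbag y hy f hf) hl
      exact ⟨u, hu, h₂, (hinr y hy f hf ⟨u, hsub hu⟩).symm.trans (phi_eq_gt_iff.2 h₁)⟩
    · rintro ⟨h₁, h₂⟩
      have h₃ := phi_eq_lt_iff.2 ((phi_eq_lt_iff.1 ((hinr y hy f hf u).trans h₁)).trans h₂)
      have h₄ := hinr y hy f hf ⟨up, hupmem⟩
      rw [h, h₃] at h₄
      cases h₄
    · rintro ⟨h₁, h₂⟩
      have h₃ := phi_eq_gt_iff.2 (h₂.trans (phi_eq_gt_iff.1 ((hinr y hy f hf u).trans h₁)))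
      have h₄ := hinr y hy f hf ⟨up, hupmem⟩
      rw [h, h₃] at h₄
      cases h₄
    · have hR' : ∀ x, ∃ t : ↥(Bags i') ⊕ (↥(Bags i') → Rel3), x ∈ T' \ Xp →
          (∀ u : ↥(Bags i), R x = Sum.inl u → ∃ h' : (u : U) ∈ Bags i', t = Sum.inl ⟨u, h'⟩) ∧
          (∀ f : ↥(Bags i) → Rel3, R x = Sum.inr f →
            t = Sum.inr (fun w => f (Set.inclusion hsub w))) := by
        intro x
        by_cases hx : x ∈ T' \ Xp
        · rcases hcase x hx.1 hx.2 with ⟨u, hu, hR, -⟩ | ⟨f, hR, -⟩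
          · refine ⟨Sum.inl ⟨u, hu⟩, fun _ => ⟨fun w hw => ?_, fun f hf => ?_⟩⟩
            · obtain rfl := Sum.inl_injective (hR.symm.trans hw)
              exact ⟨hu, rfl⟩
            · cases hR.symm.trans hf
          · refine ⟨Sum.inr (fun w => f (Set.inclusion hsub w)),
              fun _ => ⟨fun w hw => ?_, fun g hg => ?_⟩⟩
            · cases hR.symm.trans hw
            · obtain rfl := Sum.inr_injective (hR.symm.trans hg)
              rfl
        · exact ⟨Sum.inr fun _ => Rel3.sim, fun h => absurd h hx⟩
      choose R' hR' using hR'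
      refine ⟨R', hR', π, fun x hx => hL x hx.1, fun x hx y hy => hne x hx.1 y hy.1,
        fun x hx y hy => hlt x hx.1 y hy.1, fun x hx => hA' x hx.1 hx.2, fun x hx u => ?_,
        fun x hx f hf u => ?_⟩
      · rcases hcase x hx.1 hx.2 with ⟨w, hw, hR, e⟩ | ⟨f, hR, -⟩
        · obtain ⟨_, h⟩ := (hR' x hx).1 _ hR
          rw [h, e]
          simp [Subtype.ext_iff]
        · rw [(hR' x hx).2 f hR]
          simpa using fun e : π x = u => hbag x hx.1 f hR (e ▸ u.2)
      · rcases hcase x hx.1 hx.2 with ⟨w, hw, hR, e⟩ | ⟨g, hR, hg⟩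
        · obtain ⟨_, h⟩ := (hR' x hx).1 _ hR
          cases h.symm.trans hf
        · obtain rfl := Sum.inr_injective (((hR' x hx).2 g hR).symm.trans hf)
          exact hg (Set.inclusion hsub u)
  · rintro ⟨h₁, h₂, h₃, h₄, h₅, h₆, h₇, R', hR', π, hL, hne, hlt, hA, hinl, hinr⟩
    classical
    have hfun : ∀ y ∈ T', y ∉ Xp → ∀ f, R y = Sum.inr f →
        ∀ u : ↥(Bags i'), phi (π y) u = f (Set.inclusion hsub u) := fun y hy hyX f hf =>
      hinr y ⟨hy, hyX⟩ _ ((hR' y ⟨hy, hyX⟩).2 f hf)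
    have hval : ∀ y ∈ T', y ∉ Xp → ∀ u : ↥(Bags i), R y = Sum.inl u → π y = u := by
      intro y hy hyX u hu
      obtain ⟨h', h⟩ := (hR' y ⟨hy, hyX⟩).1 u hu
      exact (hinl y ⟨hy, hyX⟩ ⟨u, h'⟩).2 h
    have hnup : ∀ y ∈ T', y ∉ Xp → π y ≠ up := fun y hy hyX e =>
      hup_notMem (e ▸ hA y ⟨hy, hyX⟩)
    have hbag : ∀ y ∈ T', y ∉ Xp → ∀ f, R y = Sum.inr f → π y ∉ Bags i' := by
      intro y hy hyX f hf hmem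
      have := (hinl y ⟨hy, hyX⟩ ⟨π y, hmem⟩).1 rfl
      rw [(hR' y ⟨hy, hyX⟩).2 f hf] at this
      cases this
    have hcomp : ∀ y ∈ T', y ∉ Xp → ∀ f, R y = Sum.inr f →
        (π y < up ↔ f ⟨up, hupmem⟩ = Rel3.lt) ∧ (up < π y ↔ f ⟨up, hupmem⟩ = Rel3.gt) := by
      intro y hy hyX f hf
      have hl : f ⟨up, hupmem⟩ = Rel3.lt → π y < up := fun h => by
        obtain ⟨u, hu, huup, hfu⟩ := h₅ y hy hyX f hf h
        exact (phi_eq_lt_iff.1 ((hfun y hy hyX f hf ⟨u, hu⟩).trans hfu)).trans huup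
      have hg : f ⟨up, hupmem⟩ = Rel3.gt → up < π y := fun h => by
        obtain ⟨u, hu, huup, hfu⟩ := h₆ y hy hyX f hf h
        exact huup.trans (phi_eq_gt_iff.1 ((hfun y hy hyX f hf ⟨u, hu⟩).trans hfu))
      refine ⟨⟨fun h => ?_, hl⟩, ⟨fun h => ?_, hg⟩⟩
      · cases hs : f ⟨up, hupmem⟩ with
        | lt => rfl
        | gt => exact absurd h (hg hs).not_gt
        | sim =>
          obtain ⟨u, hu, hvu, huup⟩ := hbelow _ (hA y ⟨hy, hyX⟩) (hbag y hy hyX f hf) h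
          exact absurd ⟨(hfun y hy hyX f hf ⟨u, hu⟩).symm.trans (phi_eq_lt_iff.2 hvu), huup⟩
            (h₇ y hy hyX f hf hs ⟨u, hsub hu⟩).1
      · cases hs : f ⟨up, hupmem⟩ with
        | lt => exact absurd h (hl hs).not_gt
        | gt => rfl
        | sim =>
          obtain ⟨u, hu, hvu, huup⟩ := habove _ (hA y ⟨hy, hyX⟩) (hbag y hy hyX f hf) h
          exact absurd ⟨(hfun y hy hyX f hf ⟨u, hu⟩).symm.trans (phi_eq_gt_iff.2 hvu), huup⟩
            (h₇ y hy hyX f hf hs ⟨u, hsub hu⟩).2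
    refine ⟨fun x => if x ∈ Xp then up else π x, fun x hx => ?_, fun x hx y hy h => ?_,
      fun x hx y hy h => ?_, fun x hx => ?_, fun x hx u => ?_, fun x hx f hf u => ?_⟩
    · by_cases hX : x ∈ Xp
      · simpa [hX] using h₁ x hX
      · simpa [hX] using hL x ⟨hx, hX⟩
    · by_cases hX : x ∈ Xp <;> by_cases hY : y ∈ Xp
      · exact absurd h (h₂ x hX y hY).1
      · simpa [hX, hY] using (hnup y hy hY).symm
      · simpa [hX, hY] using hnup x hx hX
      · simpa [hX, hY] using hne x ⟨hx, hX⟩ y ⟨hy, hY⟩ h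
    · by_cases hX : x ∈ Xp <;> by_cases hY : y ∈ Xp
      · exact absurd h (h₂ x hX y hY).2
      · simp only [hX, hY, if_true, if_false]
        rcases h₄ y hy hY x hX h with ⟨u, hu, hR, hlu⟩ | ⟨f, hR, hf⟩
        · exact hval y hy hY _ hR ▸ hlu
        · exact (hcomp y hy hY f hR).2.2 hf
      · simp only [hX, hY, if_true, if_false]
        rcases h₃ x hx hX y hY h with ⟨u, hu, hR, hlu⟩ | ⟨f, hR, hf⟩
        · exact hval x hx hX _ hR ▸ hlu
        · exact (hcomp x hx hX f hR).1.2 hf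
      · simpa [hX, hY] using hlt x ⟨hx, hX⟩ y ⟨hy, hY⟩ h
    · by_cases hX : x ∈ Xp
      · simpa [hX] using mem_allowedUsers_iff.2 ⟨i, .refl T root i, hupmem⟩
      · simpa [hX] using hallowed _ (hA x ⟨hx, hX⟩)
    · by_cases hX : x ∈ Xp
      · simp [hX, (hXmem.1 hX).2, Subtype.ext_iff]
      · simp only [hX, if_false]
        refine ⟨fun e => ?_, hval x hx hX u⟩
        have hu' : (u : U) ∈ Bags i' := hmem_of_ne u u.2 (e ▸ hnup x hx hX)
        rcases hR : R x with w | f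
        · exact congrArg Sum.inl (Subtype.ext ((hval x hx hX w hR).symm.trans e))
        · exact absurd (e ▸ hu') (hbag x hx hX f hR)
    · have hX : x ∉ Xp := fun hX => by cases (hXmem.1 hX).2.symm.trans hf
      simp only [hX, if_false]
      by_cases hu : (u : U) = up
      · obtain rfl : u = ⟨up, hupmem⟩ := Subtype.ext hu
        exact phi_eq_of_iff (hcomp x hx hX f hf).1 (hcomp x hx hX f hf).2
      · exact hfun x hx hX f hf ⟨u, hmem_of_ne u u.2 hu⟩
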